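/- arXiv:1608.00443 — 2 statements merged into one kernel-verified Lean document; each statement's English description precedes it below -/
import Mathlib

section
/- Let (Ω, Σ, Q) be a probability space and let (B_k)_{k≥1} be a sequence of events such that ∑_{k=1}^∞ Q(B_k) = ∞, and suppose there exists a constant M > 0 such that for every j ≥ 2 one has ∑_{i=1}^{j−1} ( Q(B_i ∩ B_j) − Q(B_i)·Q(B_j) ) ≤ M·Q(B_j). Then Q(limsup_{k→∞} B_k) = 1. -/
open MeasureTheory Filter Finset ENNReal

lemma bc_cov_int {Ω : Type*} [MeasurableSpace Ω] (Q : Measure Ω) [IsProbabilityMeasure Q]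
    (A C : Set Ω) (hA : MeasurableSet A) (hC : MeasurableSet C) :
    ∫ ω, (A.indicator (fun _ => (1:ℝ)) ω - Q.real A) * (C.indicator (fun _ => (1:ℝ)) ω - Q.real C) ∂Q
      = Q.real (A ∩ C) - Q.real A * Q.real C := by
  have h1 : ∀ ω, (A.indicator (fun _ => (1:ℝ)) ω - Q.real A) *
      (C.indicator (fun _ => (1:ℝ)) ω - Q.real C)
      = (A ∩ C).indicator (fun _ => (1:ℝ)) ω - Q.real C * A.indicator (fun _ => (1:ℝ)) ω
        - Q.real A * C.indicator (fun _ => (1:ℝ)) ω + Q.real A * Q.real C := by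
    intro ω
    by_cases ha : ω ∈ A <;> by_cases hc : ω ∈ C <;> simp [ha, hc] <;> ring
  have i : ∀ D : Set Ω, MeasurableSet D → Integrable (D.indicator (fun _ => (1:ℝ))) Q :=
    fun D hD => (integrable_const _).indicator hD
  have v : ∀ D : Set Ω, MeasurableSet D → ∫ ω, D.indicator (fun _ => (1:ℝ)) ω ∂Q = Q.real D := by
    intro D hD
    rw [integral_indicator hD]; simp
  have iA := i A hA
  have iC := i C hC
  have iAC := i _ (hA.inter hC)
  have i2 : Integrable (fun ω => (A ∩ C).indicator (fun _ => (1:ℝ)) ω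
      - Q.real C * A.indicator (fun _ => (1:ℝ)) ω) Q := iAC.sub (iA.const_mul _)
  have i3 : Integrable (fun ω => (A ∩ C).indicator (fun _ => (1:ℝ)) ω
      - Q.real C * A.indicator (fun _ => (1:ℝ)) ω
      - Q.real A * C.indicator (fun _ => (1:ℝ)) ω) Q := i2.sub (iC.const_mul _)
  simp_rw [h1]
  rw [integral_add i3 (integrable_const _),
    integral_sub i2 (iC.const_mul _),
    integral_sub iAC (iA.const_mul _), integral_const_mul, integral_const_mul,
    v _ hA, v _ hC, v _ (hA.inter hC)]
  simp
  ring

/-- If `∑ Q(B k) = ∞` and there is a constant `M > 0` such that for each `j` the sum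
of the covariances `Q(B i ∩ B j) − Q(B i)·Q(B j)` over `i < j` is at most `M·Q(B j)`,
then almost surely infinitely many of the events `B k` occur. -/
theorem borel_cantelli_of_covariance_bound
    {Ω : Type*} [MeasurableSpace Ω] (Q : Measure Ω) [IsProbabilityMeasure Q]
    (B : ℕ → Set Ω) (hB : ∀ k, MeasurableSet (B k))
    (hdiv : ∑' k, Q (B k) = ∞)
    (hcov : ∃ M : ℝ, 0 < M ∧ ∀ j : ℕ, 1 ≤ j →
      ∑ i ∈ Finset.range j,
          ((Q (B i ∩ B j)).toReal - (Q (B i)).toReal * (Q (B j)).toReal)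
        ≤ M * (Q (B j)).toReal) :
    Q (limsup B atTop) = 1 := by
  obtain ⟨M, hM, hcov⟩ := hcov
  set p : ℕ → ℝ := fun k => Q.real (B k) with hp
  set X : ℕ → Ω → ℝ := fun k ω => (B k).indicator (fun _ => (1:ℝ)) ω - p k with hX
  have hp0 : ∀ k, 0 ≤ p k := fun k => measureReal_nonneg
  have hXm : ∀ k, Measurable (X k) := fun k =>
    (measurable_const.indicator (hB k)).sub measurable_const
  have hX2 : ∀ k, MemLp (X k) 2 Q := by
    intro k
    exact ((memLp_const (1:ℝ)).indicator (hB k)).sub (memLp_const _)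
  have hY2 : ∀ k, MemLp (fun ω => ∑ i ∈ Finset.range k, X i ω) 2 Q := fun k =>
    memLp_finsetSum _ (fun i _ => hX2 i)
  have hV : ∀ k, ∫ ω, (∑ i ∈ Finset.range k, X i ω) ^ 2 ∂Q
      ≤ (2 * M + 1) * ∑ i ∈ Finset.range k, p i := by
    intro k
    induction k with
    | zero => simp
    | succ k ih =>
      have e : ∀ ω, (∑ i ∈ Finset.range (k+1), X i ω) ^ 2
          = (∑ i ∈ Finset.range k, X i ω) ^ 2 + 2 * (∑ i ∈ Finset.range k, X i ω * X k ω)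
            + X k ω * X k ω := by
        intro ω
        rw [Finset.sum_range_succ, ← Finset.sum_mul]; ring
      have iXX : ∀ i j, Integrable (fun ω => X i ω * X j ω) Q := fun i j =>
        (hX2 i).integrable_mul (hX2 j)
      have iS : Integrable (fun ω => ∑ i ∈ Finset.range k, X i ω * X k ω) Q :=
        integrable_finsetSum _ (fun i _ => iXX i k)
      have i2 : Integrable (fun ω => (∑ i ∈ Finset.range k, X i ω) ^ 2
          + 2 * (∑ i ∈ Finset.range k, X i ω * X k ω)) Q :=
        (hY2 k).integrable_sq.add (iS.const_mul _)
      simp_rw [e]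
      rw [integral_add i2 (iXX k k),
        integral_add (hY2 k).integrable_sq (iS.const_mul _), integral_const_mul,
        integral_finsetSum _ (fun i _ => iXX i k), Finset.sum_range_succ]
      have c : ∀ i j, ∫ ω, X i ω * X j ω ∂Q = Q.real (B i ∩ B j) - p i * p j := fun i j =>
        bc_cov_int Q _ _ (hB i) (hB j)
      simp_rw [c]
      have h2 : ∑ i ∈ Finset.range k, (Q.real (B i ∩ B k) - p i * p k) ≤ M * p k := by
        rcases Nat.eq_zero_or_pos k with rfl | hk
        · simpa using mul_nonneg hM.le (hp0 0)
        · exact hcov k hk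
      have h3 : Q.real (B k ∩ B k) = p k := by rw [Set.inter_self]
      rw [h3]
      nlinarith [mul_self_nonneg (p k)]
  have hT : Tendsto (fun k => ∑ i ∈ Finset.range k, p i) atTop atTop := by
    rw [← not_summable_iff_tendsto_nat_atTop_of_nonneg hp0]
    intro hs
    have := hs.tsum_ofReal_ne_top
    apply this
    rw [← hdiv]
    congr 1
    ext k
    exact ofReal_measureReal
  have key : ∀ n : ℕ, ∀ᵐ ω ∂Q, ∃ k, n ≤ k ∧ ω ∈ B k := by
    intro n
    rw [ae_iff]
    set D := {ω | ¬ ∃ k, n ≤ k ∧ ω ∈ B k} with hD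
    by_contra hne
    have hq : 0 < Q.real D := ENNReal.toReal_pos hne (measure_ne_top _ _)
    set q := Q.real D with hqd
    obtain ⟨k, hk1, hk2⟩ := ((hT.eventually_ge_atTop (2 * (n:ℝ) + 1)).and
      (hT.eventually_gt_atTop (4 * (2 * M + 1) / q))).exists
    set S := ∑ i ∈ Finset.range k, p i with hS
    have hn0 : (0:ℝ) ≤ n := Nat.cast_nonneg n
    have hsub : D ⊆ {ω | (S - n) ^ 2 ≤ (∑ i ∈ Finset.range k, X i ω) ^ 2} := by
      intro ω hω
      have hω' : ∀ j, n ≤ j → ω ∉ B j := fun j hj hb => hω ⟨j, hj, hb⟩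
      have hN : ∑ i ∈ Finset.range k, (B i).indicator (fun _ => (1:ℝ)) ω ≤ n := by
        calc ∑ i ∈ Finset.range k, (B i).indicator (fun _ => (1:ℝ)) ω
            ≤ ∑ i ∈ Finset.range k, (if i < n then (1:ℝ) else 0) := by
              apply Finset.sum_le_sum
              intro i _
              split_ifs with hi
              · exact Set.indicator_le_self' (fun _ _ => zero_le_one) ω
              · rw [Set.indicator_of_notMem (hω' i (not_lt.mp hi))]
          _ = (((Finset.range k).filter (· < n)).card : ℝ) := by simp
          _ ≤ n := by
              have : (Finset.range k).filter (· < n) ⊆ Finset.range n := by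
                intro i hi
                simp at hi ⊢
                exact hi.2
              have := Finset.card_le_card this
              rw [Finset.card_range] at this
              exact_mod_cast this
      have hE : ∑ i ∈ Finset.range k, X i ω
          = ∑ i ∈ Finset.range k, (B i).indicator (fun _ => (1:ℝ)) ω - S := by
        simp only [hX, hS, Finset.sum_sub_distrib]
      show (S - n) ^ 2 ≤ (∑ i ∈ Finset.range k, X i ω) ^ 2
      rw [hE]
      nlinarith
    have hmk := mul_meas_ge_le_integral_of_nonneg (μ := Q)
      (f := fun ω => (∑ i ∈ Finset.range k, X i ω) ^ 2)
      (Eventually.of_forall (fun ω => sq_nonneg _)) (hY2 k).integrable_sq ((S - n) ^ 2)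
    have hle : q ≤ Q.real {ω | (S - n) ^ 2 ≤ (∑ i ∈ Finset.range k, X i ω) ^ 2} :=
      measureReal_mono hsub
    have h1 : (S - n) ^ 2 * q ≤ (2 * M + 1) * S :=
      (mul_le_mul_of_nonneg_left hle (sq_nonneg _)).trans (hmk.trans (hV k))
    rw [div_lt_iff₀ hq] at hk2
    have hSp : 0 < S := by linarith
    have h4 : S ^ 2 / 4 ≤ (S - n) ^ 2 := by nlinarith
    have h5 : S ^ 2 / 4 * q ≤ (S - n) ^ 2 * q := mul_le_mul_of_nonneg_right h4 hq.le
    have h6 := mul_lt_mul_of_pos_left hk2 hSp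
    nlinarith
  have hms : MeasurableSet (limsup B atTop) := MeasurableSet.measurableSet_limsup hB
  rw [← mem_ae_iff_prob_eq_one hms]
  filter_upwards [ae_all_iff.mpr key] with ω hω
  rw [mem_limsup_iff_frequently_mem, frequently_atTop]
  exact hω
end

section
/- For every x ∈ (0, 1], ∫∫_{ {(v,t) ∈ [0,1/2]² : √v + √t < x} } (1/(2π)) · (v·t)^{−1/2} · (1 − v − t)^{−3/2} dv dt ≥ x²/4, where the integral is with respect to planar Lebesgue measure. In particular there is a constant c > 0 such that this integral is at least c·x² for all sufficiently small x > 0. -/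
open MeasureTheory Real Filter

lemma h_intOn (B : ℝ) (hB : 0 ≤ B) :
    IntegrableOn (fun v : ℝ => v ^ (-(1 / 2 : ℝ))) (Set.Icc 0 B) := by
  rw [integrableOn_Icc_iff_integrableOn_Ioc,
    ← intervalIntegrable_iff_integrableOn_Ioc_of_le hB]
  exact intervalIntegral.intervalIntegrable_rpow' (by norm_num)

lemma G_intOn : IntegrableOn
    (fun p : ℝ × ℝ => p.1 ^ (-(1 / 2 : ℝ)) * p.2 ^ (-(1 / 2 : ℝ)))
    (Set.Icc (0 : ℝ) (1 / 2) ×ˢ Set.Icc (0 : ℝ) (1 / 2)) := by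
  have h := h_intOn (1/2) (by norm_num)
  unfold IntegrableOn at *
  rw [Measure.volume_eq_prod, ← Measure.prod_restrict]
  exact h.mul_prod h

lemma inner_int (m : ℝ) (hm : 0 ≤ m) :
    ∫ t in Set.Ioo 0 (m ^ 2), t ^ (-(1 / 2 : ℝ)) = 2 * m := by
  rw [← integral_Ioc_eq_integral_Ioo, ← intervalIntegral.integral_of_le (by positivity),
    integral_rpow (by left; norm_num)]
  have : (-(1 / 2 : ℝ)) + 1 = 1 / 2 := by norm_num
  rw [this, ← Real.sqrt_eq_rpow, ← Real.sqrt_eq_rpow, Real.sqrt_sq hm]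
  simp
  ring

lemma half_int (a b : ℝ) (ha : 0 ≤ a) (hb : 0 ≤ b) :
    ∫ t in (a ^ 2)..(b ^ 2), t ^ (-(1 / 2 : ℝ)) = 2 * (b - a) := by
  rw [integral_rpow (by left; norm_num)]
  have : (-(1 / 2 : ℝ)) + 1 = 1 / 2 := by norm_num
  rw [this, ← Real.sqrt_eq_rpow, ← Real.sqrt_eq_rpow, Real.sqrt_sq ha, Real.sqrt_sq hb]
  ring

/-- inner region -/
def Rg (x : ℝ) : Set (ℝ × ℝ) :=
  {p | p.1 ∈ Set.Ioc (0 : ℝ) ((7 / 10 * x) ^ 2) ∧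
    p.2 ∈ Set.Ioo (0 : ℝ) ((min (7 / 10 * x) (x - √p.1)) ^ 2)}

lemma Rg_meas (x : ℝ) : MeasurableSet (Rg x) := by
  have h1 : MeasurableSet {p : ℝ × ℝ | p.1 ∈ Set.Ioc (0 : ℝ) ((7 / 10 * x) ^ 2)} :=
    measurable_fst measurableSet_Ioc
  have h2 : MeasurableSet {p : ℝ × ℝ | (0 : ℝ) < p.2} :=
    measurableSet_lt (by fun_prop) (by fun_prop)
  have h3 : MeasurableSet {p : ℝ × ℝ | p.2 < (min (7 / 10 * x) (x - √p.1)) ^ 2} :=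
    measurableSet_lt (by fun_prop) (by fun_prop)
  exact h1.inter (h2.inter h3)

lemma sqrt_le_of {x v : ℝ} (hx : 0 < x) (hv : v ≤ (7 / 10 * x) ^ 2) : √v ≤ 7 / 10 * x := by
  exact Real.sqrt_le_iff.2 ⟨by positivity, hv⟩

lemma Rg_sub (x : ℝ) (hx : 0 < x) (hx1 : x ≤ 1) :
    Rg x ⊆ {p : ℝ × ℝ | p.1 ∈ Set.Icc (0 : ℝ) (1 / 2) ∧ p.2 ∈ Set.Icc (0 : ℝ) (1 / 2) ∧
          Real.sqrt p.1 + Real.sqrt p.2 < x} := by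
  rintro ⟨v, t⟩ ⟨⟨h1, h2⟩, h3, h4⟩
  simp only at h1 h2 h3 h4
  have h5 := sqrt_le_of hx h2
  have hm : 0 < min (7 / 10 * x) (x - √v) := lt_min (by positivity) (by linarith)
  have h6 : √t < min (7 / 10 * x) (x - √v) := (Real.sqrt_lt' hm).2 h4
  have h7 := min_le_left (7 / 10 * x) (x - √v)
  have h8 := min_le_right (7 / 10 * x) (x - √v)
  refine ⟨⟨h1.le, by nlinarith⟩, ⟨h3.le, ?_⟩, ?_⟩
  · show t ≤ 1 / 2
    nlinarith
  · show √v + √t < x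
    linarith

lemma Rg_int (x : ℝ) (hx : 0 < x)
    (hi : IntegrableOn (fun p : ℝ × ℝ => p.1 ^ (-(1 / 2 : ℝ)) * p.2 ^ (-(1 / 2 : ℝ))) (Rg x)) :
    ∫ p in Rg x, p.1 ^ (-(1 / 2 : ℝ)) * p.2 ^ (-(1 / 2 : ℝ)) = 41 / 25 * x ^ 2 := by
  rw [← integral_indicator (Rg_meas x)]
  rw [← integrable_indicator_iff (Rg_meas x)] at hi
  rw [Measure.volume_eq_prod] at hi ⊢
  rw [integral_prod _ hi]
  have key : ∀ v : ℝ, (∫ t, (Rg x).indicator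
      (fun p : ℝ × ℝ => p.1 ^ (-(1 / 2 : ℝ)) * p.2 ^ (-(1 / 2 : ℝ))) (v, t)) =
      (Set.Ioc (0 : ℝ) ((7 / 10 * x) ^ 2)).indicator
        (fun v => v ^ (-(1 / 2 : ℝ)) * (2 * min (7 / 10 * x) (x - √v))) v := by
    intro v
    by_cases hv : v ∈ Set.Ioc (0 : ℝ) ((7 / 10 * x) ^ 2)
    · rw [Set.indicator_of_mem hv]
      have h5 := sqrt_le_of hx hv.2
      rw [← inner_int _ (le_min (by positivity) (by linarith)), ← integral_const_mul,
        ← integral_indicator measurableSet_Ioo]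
      congr 1
      ext t
      simp only [Set.indicator, Rg, Set.mem_ofPred_eq, hv, true_and]
    · rw [Set.indicator_of_notMem hv]
      simp only [Set.indicator, Rg, Set.mem_ofPred_eq, hv, false_and, if_false, integral_zero]
  simp_rw [key]
  rw [integral_indicator measurableSet_Ioc, ← intervalIntegral.integral_of_le (by positivity)]
  have hI : ∀ a b : ℝ, IntervalIntegrable
      (fun v : ℝ => v ^ (-(1 / 2 : ℝ)) * (2 * min (7 / 10 * x) (x - √v))) volume a b := by
    intro a b
    exact (intervalIntegral.intervalIntegrable_rpow' (by norm_num)).mul_continuousOn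
      (by fun_prop)
  rw [← intervalIntegral.integral_add_adjacent_intervals (hI 0 ((3 / 10 * x) ^ 2)) (hI _ _)]
  have e1 : ∫ v in (0:ℝ)..((3 / 10 * x) ^ 2),
      v ^ (-(1 / 2 : ℝ)) * (2 * min (7 / 10 * x) (x - √v)) =
      ∫ v in (0:ℝ)..((3 / 10 * x) ^ 2), v ^ (-(1 / 2 : ℝ)) * (7 / 5 * x) := by
    apply intervalIntegral.integral_congr
    intro v hv
    rw [Set.uIcc_of_le (by positivity)] at hv
    have : √v ≤ 3 / 10 * x := Real.sqrt_le_iff.2 ⟨by positivity, hv.2⟩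
    simp only
    rw [min_eq_left (by linarith)]
    ring
  have e2 : ∫ v in ((3 / 10 * x) ^ 2)..((7 / 10 * x) ^ 2),
      v ^ (-(1 / 2 : ℝ)) * (2 * min (7 / 10 * x) (x - √v)) =
      ∫ v in ((3 / 10 * x) ^ 2)..((7 / 10 * x) ^ 2), (v ^ (-(1 / 2 : ℝ)) * (2 * x) - 2) := by
    apply intervalIntegral.integral_congr
    intro v hv
    rw [Set.uIcc_of_le (by nlinarith)] at hv
    have h1 : 3 / 10 * x ≤ √v := Real.le_sqrt_of_sq_le hv.1
    have hv0 : 0 < v := lt_of_lt_of_le (by positivity) hv.1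
    have h2 : v ^ (-(1 / 2 : ℝ)) * √v = 1 := by
      rw [Real.sqrt_eq_rpow, ← Real.rpow_add hv0]
      norm_num
    simp only
    rw [min_eq_right (by linarith)]
    linear_combination (-2) * h2
  rw [e1, e2, intervalIntegral.integral_sub, intervalIntegral.integral_mul_const,
    intervalIntegral.integral_mul_const, half_int _ _ (by positivity) (by positivity)]
  · have := half_int 0 (3 / 10 * x) le_rfl (by positivity)
    rw [zero_pow two_ne_zero] at this
    rw [this, intervalIntegral.integral_const, smul_eq_mul]
    ring
  · exact (intervalIntegral.intervalIntegrable_rpow' (by norm_num)).mul_const _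
  · exact intervalIntegrable_const

lemma main_bound (x : ℝ) (hx : 0 < x) (hx1 : x ≤ 1) :
      (∫ p in {p : ℝ × ℝ | p.1 ∈ Set.Icc (0 : ℝ) (1 / 2) ∧ p.2 ∈ Set.Icc (0 : ℝ) (1 / 2) ∧
          Real.sqrt p.1 + Real.sqrt p.2 < x},
        (1 / (2 * π)) * (p.1 * p.2) ^ (-(1 / 2 : ℝ)) * (1 - p.1 - p.2) ^ (-(3 / 2 : ℝ))
          ∂(volume : Measure (ℝ × ℝ)))
        ≥ x ^ 2 / 4 := by
  have hsub := Rg_sub x hx hx1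
  set S := {p : ℝ × ℝ | p.1 ∈ Set.Icc (0 : ℝ) (1 / 2) ∧ p.2 ∈ Set.Icc (0 : ℝ) (1 / 2) ∧
          Real.sqrt p.1 + Real.sqrt p.2 < x} with hS
  have hSm : MeasurableSet S := by
    refine MeasurableSet.inter ?_ (MeasurableSet.inter ?_ ?_)
    · exact measurable_fst measurableSet_Icc
    · exact measurable_snd measurableSet_Icc
    · have h3 : MeasurableSet {p : ℝ × ℝ | √p.1 + √p.2 < x} :=
        measurableSet_lt (by fun_prop) (by fun_prop)
      exact h3
  have hGS : IntegrableOn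
      (fun p : ℝ × ℝ => p.1 ^ (-(1 / 2 : ℝ)) * p.2 ^ (-(1 / 2 : ℝ))) S :=
    G_intOn.mono_set (fun p hp => ⟨hp.1, hp.2.1⟩)
  have hGR := hGS.mono_set hsub
  have hb : ∀ p ∈ S, 1 / 4 ≤ 1 - p.1 - p.2 ∧ 1 - p.1 - p.2 ≤ 1 := by
    rintro ⟨v, t⟩ ⟨⟨h1, h2⟩, ⟨h3, h4⟩, h5⟩
    simp only at *
    refine ⟨?_, by linarith⟩
    have ha := Real.sqrt_nonneg v
    have hb := Real.sqrt_nonneg t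
    have ha2 := Real.sq_sqrt h1
    have hb2 := Real.sq_sqrt h3
    have ha3 : √v ≤ 3 / 4 := Real.sqrt_le_iff.2 ⟨by norm_num, by linarith⟩
    have hb3 : √t ≤ 3 / 4 := Real.sqrt_le_iff.2 ⟨by norm_num, by linarith⟩
    nlinarith
  have hfac : ∀ p ∈ S, 1 ≤ (1 - p.1 - p.2) ^ (-(3 / 2 : ℝ)) ∧
      (1 - p.1 - p.2) ^ (-(3 / 2 : ℝ)) ≤ (1 / 4 : ℝ) ^ (-(3 / 2 : ℝ)) := by
    intro p hp
    obtain ⟨h1, h2⟩ := hb p hp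
    exact ⟨Real.one_le_rpow_of_pos_of_le_one_of_nonpos (by linarith) h2 (by norm_num),
      Real.rpow_le_rpow_of_nonpos (by norm_num) h1 (by norm_num)⟩
  have hmul : ∀ p ∈ S, (p.1 * p.2) ^ (-(1 / 2 : ℝ)) =
      p.1 ^ (-(1 / 2 : ℝ)) * p.2 ^ (-(1 / 2 : ℝ)) :=
    fun p hp => Real.mul_rpow hp.1.1 hp.2.1.1
  have hGn : ∀ p ∈ S, 0 ≤ p.1 ^ (-(1 / 2 : ℝ)) * p.2 ^ (-(1 / 2 : ℝ)) :=
    fun p hp => mul_nonneg (Real.rpow_nonneg hp.1.1 _) (Real.rpow_nonneg hp.2.1.1 _)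
  have hpi : 0 < 1 / (2 * π) := by positivity
  have hF : IntegrableOn (fun p : ℝ × ℝ => (1 / (2 * π)) * (p.1 * p.2) ^ (-(1 / 2 : ℝ)) *
      (1 - p.1 - p.2) ^ (-(3 / 2 : ℝ))) S := by
    refine Integrable.mono' ((hGS.const_mul (1 / (2 * π))).mul_const
      ((1 / 4 : ℝ) ^ (-(3 / 2 : ℝ)))) (Measurable.aestronglyMeasurable (by fun_prop)) ?_
    refine (ae_restrict_iff' hSm).2 (Eventually.of_forall fun p hp => ?_)
    obtain ⟨h1, h2⟩ := hfac p hp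
    have h3 := mul_nonneg hpi.le (hGn p hp)
    rw [hmul p hp, Real.norm_eq_abs, abs_of_nonneg (mul_nonneg h3 (by linarith))]
    exact mul_le_mul_of_nonneg_left h2 h3
  have step1 : (1 / (2 * π)) * ∫ p in S, p.1 ^ (-(1 / 2 : ℝ)) * p.2 ^ (-(1 / 2 : ℝ)) ≤
      ∫ p in S, (1 / (2 * π)) * (p.1 * p.2) ^ (-(1 / 2 : ℝ)) *
        (1 - p.1 - p.2) ^ (-(3 / 2 : ℝ)) := by
    rw [← integral_const_mul]
    refine setIntegral_mono_on (hGS.const_mul _) hF hSm fun p hp => ?_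
    rw [hmul p hp]
    exact le_mul_of_one_le_right (mul_nonneg hpi.le (hGn p hp)) (hfac p hp).1
  have step2 : 41 / 25 * x ^ 2 ≤ ∫ p in S, p.1 ^ (-(1 / 2 : ℝ)) * p.2 ^ (-(1 / 2 : ℝ)) := by
    rw [← Rg_int x hx hGR]
    exact setIntegral_mono_set hGS
      ((ae_restrict_iff' hSm).2 (Eventually.of_forall fun p hp => hGn p hp))
      hsub.eventuallyLE
  have step3 : x ^ 2 / 4 ≤ (1 / (2 * π)) * (41 / 25 * x ^ 2) := by
    have := Real.pi_lt_d2
    have h0 := Real.pi_pos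
    rw [one_div_mul_eq_div, le_div_iff₀ (by positivity)]
    nlinarith [sq_nonneg x]
  exact (step3.trans (mul_le_mul_of_nonneg_left step2 hpi.le)).trans step1

/-- Quadratic lower bound for the small-ball probability
`P(T₁^{1/2} + T₂^{1/2} < x)` of the reduction ratios of the zero set of the
Brownian bridge: the integral is at least `x²/4` for `x ∈ (0,1]`, and in particular
it is at least `c·x²` for some `c > 0` for all sufficiently small `x > 0`. -/
theorem integral_density_small_ball_lower_bound :
    (∀ x ∈ Set.Ioc (0 : ℝ) 1,
      (∫ p in {p : ℝ × ℝ | p.1 ∈ Set.Icc (0 : ℝ) (1 / 2) ∧ p.2 ∈ Set.Icc (0 : ℝ) (1 / 2) ∧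
          Real.sqrt p.1 + Real.sqrt p.2 < x},
        (1 / (2 * π)) * (p.1 * p.2) ^ (-(1 / 2 : ℝ)) * (1 - p.1 - p.2) ^ (-(3 / 2 : ℝ))
          ∂(volume : Measure (ℝ × ℝ)))
        ≥ x ^ 2 / 4) ∧
    ∃ c : ℝ, 0 < c ∧ ∀ᶠ x in nhdsWithin (0 : ℝ) (Set.Ioi 0),
      (∫ p in {p : ℝ × ℝ | p.1 ∈ Set.Icc (0 : ℝ) (1 / 2) ∧ p.2 ∈ Set.Icc (0 : ℝ) (1 / 2) ∧
          Real.sqrt p.1 + Real.sqrt p.2 < x},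
        (1 / (2 * π)) * (p.1 * p.2) ^ (-(1 / 2 : ℝ)) * (1 - p.1 - p.2) ^ (-(3 / 2 : ℝ))
          ∂(volume : Measure (ℝ × ℝ)))
        ≥ c * x ^ 2 := by
  refine ⟨fun x hx => main_bound x hx.1 hx.2, 1 / 4, by norm_num, ?_⟩
  filter_upwards [Ioc_mem_nhdsGT (show (0 : ℝ) < 1 by norm_num)] with x hx
  have := main_bound x hx.1 hx.2
  rw [ge_iff_le] at this ⊢
  exact le_trans (by linarith) this
end
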